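/- arXiv:2510.08361 — 2 statements merged into one kernel-verified Lean document; each statement's English description precedes it below -/
import Mathlib

section
/- If G is a connected graph with exactly m edges and G is not a triangle, then the 𝓒-isolation number of G satisfies ι(G, 𝓒) ≤ (m+1)/5. -/
open SimpleGraph

/-- The closed neighbourhood `N[D]` of a set `D` of vertices of the graph `G`. -/
def closedNbhd {V : Type*} (G : SimpleGraph V) (D : Set V) : Set V :=
  D ∪ {v | ∃ u ∈ D, G.Adj u v}

/-- `G` contains a copy of `F`, i.e. a subgraph isomorphic to `F`. -/
def HasCopy {W V : Type*} (F : SimpleGraph W) (G : SimpleGraph V) : Prop :=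
  ∃ f : F →g G, Function.Injective f

/-- `D` is an isolating set of `G` with respect to the family of all cycles of length
at least `k` : the graph `G − N[D]` contains no copy of `C_n` for any `n ≥ k`.
For `k = 3` this is the family 𝓒 of all cycles; for `k = 4` it is the family 𝓒' of
non-triangle cycles. -/
def IsCycIsolatingGE {V : Type*} (k : ℕ) (G : SimpleGraph V) (D : Set V) : Prop :=
  ∀ n, k ≤ n → ¬ HasCopy (cycleGraph n) (G.induce (closedNbhd G D)ᶜ)

/-- The isolation number of `G` with respect to the family of cycles of length at least `k`:
the least cardinality of an isolating set. -/
noncomputable def iotaCycGE {V : Type*} (k : ℕ) (G : SimpleGraph V) : ℕ :=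
  sInf {r | ∃ D : Set V, D.ncard = r ∧ IsCycIsolatingGE k G D}

section IsolationHelpers

open Classical Finset

variable {V : Type*} (G : SimpleGraph V)

/-- A nonempty finite set of vertices inducing a subgraph of minimum degree at least two. -/
def IsCore (C : Finset V) : Prop :=
  C.Nonempty ∧ ∀ v ∈ C, ∃ a ∈ C, ∃ b ∈ C, a ≠ b ∧ G.Adj v a ∧ G.Adj v b

/-- Every core contained in `W` meets the closed neighbourhood of `D`. -/
def Dominates (D W : Finset V) : Prop :=
  ∀ C ⊆ W, IsCore G C → ∃ u ∈ C, ∃ d ∈ D, d = u ∨ G.Adj d u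

/-- `A` is a union of connected components of the subgraph induced by `U`. -/
def IsClosedIn (A U : Finset V) : Prop :=
  A ⊆ U ∧ ∀ a ∈ A, ∀ b ∈ U, G.Adj a b → b ∈ A

/-- The subgraph induced by `U` is connected. -/
def ConnectedOn (U : Finset V) : Prop :=
  U.Nonempty ∧ ∀ A : Finset V, A.Nonempty → IsClosedIn G A U → A = U

/-- `H` is the vertex set of a triangle. -/
def IsTriangle (H : Finset V) : Prop :=
  ∃ a b c, G.Adj a b ∧ G.Adj b c ∧ G.Adj a c ∧ H = {a, b, c}

/-- The edges with both ends in `U`. -/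
noncomputable def edgesIn [Fintype V] (U : Finset V) : Finset (Sym2 V) :=
  G.edgeFinset.filter fun e => ∀ w ∈ e, w ∈ U

/-- The edges with both ends in `U` and at least one end in `W`. -/
noncomputable def edgesMeeting [Fintype V] (U W : Finset V) : Finset (Sym2 V) :=
  (edgesIn G U).filter fun e => ∃ w ∈ e, w ∈ W

variable {G}

lemma mk_mem_edgesIn [Fintype V] {U : Finset V} {a b : V} :
    s(a, b) ∈ edgesIn G U ↔ G.Adj a b ∧ a ∈ U ∧ b ∈ U := by
  simp [edgesIn]

lemma mk_mem_edgesMeeting [Fintype V] {U W : Finset V} {a b : V} :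
    s(a, b) ∈ edgesMeeting G U W ↔ G.Adj a b ∧ a ∈ U ∧ b ∈ U ∧ (a ∈ W ∨ b ∈ W) := by
  simp [edgesMeeting, mk_mem_edgesIn, and_assoc]

lemma IsClosedIn.trans {A B U : Finset V} (h₁ : IsClosedIn G A B) (h₂ : IsClosedIn G B U) :
    IsClosedIn G A U :=
  ⟨h₁.1.trans h₂.1, fun a ha b hb hab => h₁.2 a ha b (h₂.2 a (h₁.1 ha) b hb hab) hab⟩

lemma IsClosedIn.sdiff {A B U : Finset V} (h₁ : IsClosedIn G A U) (h₂ : IsClosedIn G B U) :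
    IsClosedIn G (A \ B) U := by
  refine ⟨sdiff_subset.trans h₁.1, fun a ha b hb hab => ?_⟩
  rw [mem_sdiff] at ha ⊢
  exact ⟨h₁.2 a ha.1 b hb hab, fun h => ha.2 (h₂.2 b h a (h₁.1 ha.1) hab.symm)⟩

lemma IsClosedIn.refl (U : Finset V) : IsClosedIn G U U := ⟨subset_rfl, fun _ _ _ hb _ => hb⟩

lemma exists_component {W : Finset V} {c : V} (hc : c ∈ W) :
    ∃ H, c ∈ H ∧ IsClosedIn G H W ∧ ConnectedOn G H := by
  have hex : ∃ n, ∃ H : Finset V, H.card = n ∧ c ∈ H ∧ IsClosedIn G H W :=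
    ⟨_, W, rfl, hc, IsClosedIn.refl W⟩
  obtain ⟨H, hcard, hcH, hH⟩ := Nat.find_spec hex
  have hmin : ∀ A : Finset V, c ∈ A → IsClosedIn G A H → A = H := fun A hcA hA =>
    eq_of_subset_of_card_le hA.1
      (hcard ▸ Nat.find_min' hex ⟨A, rfl, hcA, hA.trans hH⟩)
  refine ⟨H, hcH, hH, ⟨c, hcH⟩, fun A hne hA => ?_⟩
  by_cases hcA : c ∈ A
  · exact hmin A hcA hA
  · have h := hmin (H \ A) (mem_sdiff.2 ⟨hcH, hcA⟩) ((IsClosedIn.refl H).sdiff hA)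
    obtain ⟨a, ha⟩ := hne
    have := hA.1 ha
    rw [← h, mem_sdiff] at this
    exact absurd ha this.2

lemma ConnectedOn.exists_adj {U H : Finset V} (hU : ConnectedOn G U) (hH : H.Nonempty)
    (hsub : H ⊆ U) (hne : H ≠ U) : ∃ a ∈ H, ∃ b ∈ U, b ∉ H ∧ G.Adj a b := by
  by_contra! hcon
  exact hne (hU.2 H hH ⟨hsub, fun a ha b hb hab => by
    by_contra hbH
    exact hcon a ha b hb hbH hab⟩)

lemma IsCore.three_le_card {C : Finset V} (hC : IsCore G C) : 3 ≤ C.card := by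
  obtain ⟨v, hv⟩ := hC.1
  obtain ⟨a, ha, b, hb, hab, hva, hvb⟩ := hC.2 v hv
  rw [← card_eq_three.2 ⟨v, a, b, hva.ne, hvb.ne, hab, rfl⟩]
  apply card_le_card
  simp [insert_subset_iff, *]

lemma Dominates.mono {D D' W : Finset V} (h : Dominates G D W) (hD : D ⊆ D') :
    Dominates G D' W := fun C hC hcore => by
  obtain ⟨u, hu, d, hd, hud⟩ := h C hC hcore
  exact ⟨u, hu, d, hD hd, hud⟩

lemma Dominates.union_closed {D A W : Finset V} (hA : IsClosedIn G A W)
    (h₁ : Dominates G D A) (h₂ : Dominates G D (W \ A)) : Dominates G D W := by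
  intro C hC hcore
  by_cases hne : (C ∩ A).Nonempty
  · have hcore' : IsCore G (C ∩ A) := by
      refine ⟨hne, fun v hv => ?_⟩
      rw [mem_inter] at hv
      obtain ⟨a, ha, b, hb, hab, hva, hvb⟩ := hcore.2 v hv.1
      exact ⟨a, mem_inter.2 ⟨ha, hA.2 v hv.2 a (hC ha) hva⟩, b,
        mem_inter.2 ⟨hb, hA.2 v hv.2 b (hC hb) hvb⟩, hab, hva, hvb⟩
    obtain ⟨u, hu, h⟩ := h₁ _ inter_subset_right hcore'
    exact ⟨u, (mem_inter.1 hu).1, h⟩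
  · refine h₂ C (fun w hw => mem_sdiff.2 ⟨hC hw, fun hwA => hne ⟨w, mem_inter.2 ⟨hw, hwA⟩⟩⟩) hcore

/-- A finite set in which at most one vertex has fewer than two neighbours contains a core. -/
lemma exists_core_of_forall_ne {X : Finset V} {h : V} (hX : ∃ w ∈ X, w ≠ h)
    (hdeg : ∀ v ∈ X, v ≠ h → ∃ a ∈ X, ∃ b ∈ X, a ≠ b ∧ G.Adj v a ∧ G.Adj v b) :
    ∃ C ⊆ X, IsCore G C := by
  induction hn : X.card using Nat.strong_induction_on generalizing X h with
  | _ n ih =>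
    by_cases hh : h ∈ X
    · by_cases h2 : ∃ a ∈ X, ∃ b ∈ X, a ≠ b ∧ G.Adj h a ∧ G.Adj h b
      · exact ⟨X, subset_rfl, ⟨h, hh⟩, fun v hv => by
          by_cases hvh : v = h
          · exact hvh ▸ h2
          · exact hdeg v hv hvh⟩
      · push Not at h2
        have key : ∃ h', (∃ w ∈ X.erase h, w ≠ h') ∧
            ∀ v ∈ X.erase h, v ≠ h' → ¬ G.Adj v h := by
          by_cases h1 : ∃ a ∈ X, G.Adj h a
          · obtain ⟨a, ha, hha⟩ := h1
            refine ⟨a, ?_, fun v hv hva hvh =>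
              h2 v (mem_of_mem_erase hv) a ha hva hvh.symm hha⟩
            obtain ⟨p, hp, q, hq, hpq, hap, haq⟩ := hdeg a ha hha.ne'
            by_cases hph : p = h
            · exact ⟨q, mem_erase.2 ⟨fun hqh => hpq (hph.trans hqh.symm), hq⟩, haq.ne'⟩
            · exact ⟨p, mem_erase.2 ⟨hph, hp⟩, hap.ne'⟩
          · push Not at h1
            obtain ⟨w, hw, hwh⟩ := hX
            exact ⟨h, ⟨w, mem_erase.2 ⟨hwh, hw⟩, hwh⟩,
              fun v hv _ hvh => h1 v (mem_of_mem_erase hv) hvh.symm⟩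
        obtain ⟨h', hex, hnot⟩ := key
        obtain ⟨C, hC, hcore⟩ := ih _ (hn ▸ card_erase_lt_of_mem hh) hex
          (fun v hv hvh' => by
            obtain ⟨a, ha, b, hb, hab, hva, hvb⟩ := hdeg v (mem_of_mem_erase hv) (ne_of_mem_erase hv)
            have hnv := hnot v hv hvh'
            exact ⟨a, mem_erase.2 ⟨fun e => hnv (e ▸ hva), ha⟩, b,
              mem_erase.2 ⟨fun e => hnv (e ▸ hvb), hb⟩, hab, hva, hvb⟩) rfl
        exact ⟨C, hC.trans (erase_subset _ _), hcore⟩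
    · obtain ⟨w, hw, -⟩ := hX
      exact ⟨X, subset_rfl, ⟨w, hw⟩, fun v hv => hdeg v hv fun e => hh (e ▸ hv)⟩

section Counting

variable [Fintype V]

lemma card_edgesMeeting_add_le {U A W : Finset V} (hA : IsClosedIn G A W) :
    (edgesMeeting G U A).card + (edgesMeeting G U (W \ A)).card ≤ (edgesMeeting G U W).card := by
  rw [← card_union_of_disjoint]
  · apply card_le_card
    intro e
    induction e with
    | _ a b =>
      have := @hA.1 a
      have := @hA.1 b
      simp only [mem_union, mk_mem_edgesMeeting, mem_sdiff]
      tauto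
  · rw [Finset.disjoint_left]
    intro e
    induction e with
    | _ a b =>
      have h1 := @hA.1 a
      have h2 := @hA.1 b
      have h3 := hA.2 a
      have h4 := hA.2 b
      simp only [mk_mem_edgesMeeting, mem_sdiff]
      rintro ⟨hab, -, -, h⟩ ⟨-, -, -, h'⟩
      have h5 := hab.symm
      grind

lemma card_edgesIn_add_le {U S : Finset V} (hS : S ⊆ U) :
    (edgesIn G S).card + (edgesMeeting G U (U \ S)).card ≤ (edgesIn G U).card := by
  rw [← card_union_of_disjoint]
  · apply card_le_card
    intro e
    induction e with
    | _ a b =>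
      have := @hS a
      have := @hS b
      simp only [mem_union, mk_mem_edgesMeeting, mk_mem_edgesIn]
      tauto
  · rw [Finset.disjoint_left]
    intro e
    induction e with
    | _ a b =>
      simp only [mk_mem_edgesMeeting, mem_sdiff, mk_mem_edgesIn]
      tauto

lemma card_edgesIn_add_one_le {U H : Finset V} (hH : H ⊆ U) {a b : V} (ha : a ∈ H) (hb : b ∈ U)
    (hbH : b ∉ H) (hab : G.Adj a b) :
    (edgesIn G H).card + 1 ≤ (edgesMeeting G U H).card := by
  rw [← card_insert_of_notMem (a := s(a, b)) (by simp [mk_mem_edgesIn, hbH])]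
  apply card_le_card
  intro e
  induction e with
  | _ p q =>
    rw [mem_insert, mk_mem_edgesIn, mk_mem_edgesMeeting]
    have := @hH p
    have := @hH q
    have := hH ha
    rintro (h | h)
    · rw [Sym2.eq_iff] at h
      have := hab.symm
      grind
    · tauto

lemma card_edgesIn_add_two_le {U H : Finset V} (hH : H ⊆ U) {a b a' b' : V} (ha : a ∈ H)
    (hb : b ∈ U) (hbH : b ∉ H) (hab : G.Adj a b) (ha' : a' ∈ H) (hb' : b' ∈ U) (hbH' : b' ∉ H)
    (hab' : G.Adj a' b') (hne : a ≠ a' ∨ b ≠ b') :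
    (edgesIn G H).card + 2 ≤ (edgesMeeting G U H).card := by
  have h1 : s(a', b') ∉ edgesIn G H := by simp [mk_mem_edgesIn, hbH']
  have h2 : s(a, b) ∉ insert s(a', b') (edgesIn G H) := by
    rw [mem_insert, mk_mem_edgesIn, Sym2.eq_iff]
    grind
  have h3 := card_insert_of_notMem h2
  rw [card_insert_of_notMem h1] at h3
  have h4 : insert s(a, b) (insert s(a', b') (edgesIn G H)) ⊆ edgesMeeting G U H := by
    intro e
    induction e with
    | _ p q =>
      rw [mem_insert, mem_insert, mk_mem_edgesIn, mk_mem_edgesMeeting, Sym2.eq_iff, Sym2.eq_iff]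
      have := @hH p
      have := @hH q
      have := hH ha
      have := hH ha'
      have := hab.symm
      have := hab'.symm
      grind
  have := card_le_card h4
  omega

lemma IsTriangle.three_le_card_edgesIn {H : Finset V} (hH : IsTriangle G H) : 3 ≤ (edgesIn G H).card := by
  obtain ⟨a, b, c, hab, hbc, hac, rfl⟩ := hH
  have h : ({s(a, b), s(b, c), s(a, c)} : Finset (Sym2 V)).card = 3 := by
    rw [card_eq_three]
    refine ⟨_, _, _, ?_, ?_, ?_, rfl⟩ <;> rw [Ne, Sym2.eq_iff] <;>
    · have := hab.ne
      have := hbc.ne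
      have := hac.ne
      grind
  rw [← h]
  apply card_le_card
  simp [insert_subset_iff, mk_mem_edgesIn, hab, hbc, hac]

lemma exists_dominates_of_components {U Z : Finset V} {x : V}
    (hcomp : ∀ H, IsClosedIn G H Z → ConnectedOn G H →
      ∃ D : Finset V, 5 * D.card ≤ (edgesMeeting G U H).card ∧ Dominates G (insert x D) H)
    {W : Finset V} (hW : IsClosedIn G W Z) :
    ∃ D : Finset V, 5 * D.card ≤ (edgesMeeting G U W).card ∧ Dominates G (insert x D) W := by
  induction hn : W.card using Nat.strong_induction_on generalizing W with
  | _ n ih =>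
    rcases W.eq_empty_or_nonempty with rfl | ⟨c, hc⟩
    · exact ⟨∅, by simp, fun C hC hcore => absurd hcore.1 (by simp [subset_empty.1 hC])⟩
    · obtain ⟨H, hcH, hHW, hH⟩ := exists_component (G := G) hc
      obtain ⟨D₁, hD₁, hdom₁⟩ := hcomp H (hHW.trans hW) hH
      have hlt : (W \ H).card < n :=
        hn ▸ card_lt_card (sdiff_ssubset hHW.1 ⟨c, hcH⟩)
      obtain ⟨D₂, hD₂, hdom₂⟩ := ih _ hlt (hW.sdiff (hHW.trans hW)) rfl
      refine ⟨D₁ ∪ D₂, ?_, ?_⟩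
      · have := card_union_le D₁ D₂
        have := card_edgesMeeting_add_le (U := U) hHW
        omega
      · exact Dominates.union_closed hHW
          (hdom₁.mono (insert_subset_insert _ subset_union_left))
          (hdom₂.mono (insert_subset_insert _ subset_union_right))

lemma exists_dominates_of_delete {U S : Finset V} {x : V} (hS : S ⊆ U)
    (hSx : ∀ w ∈ S, x = w ∨ G.Adj x w)
    (hcomp : ∀ H, IsClosedIn G H (U \ S) → ConnectedOn G H →
      ∃ D : Finset V, 5 * D.card ≤ (edgesMeeting G U H).card ∧ Dominates G (insert x D) H)
    {H₀ D₀ : Finset V} (hH₀ : IsClosedIn G H₀ (U \ S)) (hdom : Dominates G (insert x D₀) H₀)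
    (hcard : 5 * D₀.card + 4 ≤ (edgesMeeting G U H₀).card + (edgesIn G S).card) :
    ∃ D : Finset V, 5 * D.card ≤ (edgesIn G U).card + 1 ∧ Dominates G D U := by
  obtain ⟨D₁, hD₁, hdom₁⟩ := exists_dominates_of_components hcomp ((IsClosedIn.refl _).sdiff hH₀)
  refine ⟨insert x (D₀ ∪ D₁), ?_, ?_⟩
  · have := card_insert_le x (D₀ ∪ D₁)
    have := card_union_le D₀ D₁
    have := card_edgesMeeting_add_le (U := U) hH₀
    have := card_edgesIn_add_le (G := G) hS
    omega
  · intro C hC hcore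
    by_cases hCS : ∃ u ∈ C, u ∈ S
    · obtain ⟨u, hu, huS⟩ := hCS
      exact ⟨u, hu, x, mem_insert_self _ _, hSx u huS⟩
    · refine Dominates.union_closed hH₀
        (hdom.mono (insert_subset_insert _ subset_union_left))
        (hdom₁.mono (insert_subset_insert _ subset_union_right)) C (fun w hw => ?_) hcore
      exact mem_sdiff.2 ⟨hC hw, fun hwS => hCS ⟨w, hw, hwS⟩⟩

lemma four_le_card_edgesIn {S : Finset V} {p q r s : V} (hpq : G.Adj p q) (hpr : G.Adj p r)
    (hqr : G.Adj q r) (hps : G.Adj p s) (hsq : s ≠ q) (hsr : s ≠ r)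
    (hp : p ∈ S) (hq : q ∈ S) (hr : r ∈ S) (hs : s ∈ S) : 4 ≤ (edgesIn G S).card := by
  have hT : IsTriangle G {p, q, r} := ⟨p, q, r, hpq, hqr, hpr, rfl⟩
  have h1 := hT.three_le_card_edgesIn
  have h2 : s(p, s) ∉ edgesIn G {p, q, r} := by
    rw [mk_mem_edgesIn]
    simp [hsq, hsr, hps.ne']
  have h3 := card_insert_of_notMem h2
  have h4 : insert s(p, s) (edgesIn G {p, q, r}) ⊆ edgesIn G S := by
    intro e
    induction e with
    | _ a b =>
      rw [mem_insert, mk_mem_edgesIn, mk_mem_edgesIn, Sym2.eq_iff]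
      have := hps.symm
      simp only [mem_insert, mem_singleton]
      grind
  have := card_le_card h4
  omega

lemma ConnectedOn.exists_dominates {U : Finset V} (hU : ConnectedOn G U)
    (hT : ¬ IsTriangle G U) :
    ∃ D : Finset V, 5 * D.card ≤ (edgesIn G U).card + 1 ∧ Dominates G D U := by
  induction hn : U.card using Nat.strong_induction_on generalizing U with
  | _ n ih =>
    have hsmall : ∀ H ⊆ U, H ≠ U → ConnectedOn G H → ¬ IsTriangle G H →
        ∃ D : Finset V, 5 * D.card ≤ (edgesIn G H).card + 1 ∧ Dominates G D H :=
      fun H hHU hne hH hHT => ih _ (hn ▸ card_lt_card (hHU.ssubset_of_ne hne)) hH hHT rfl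
    have hnice : ∀ x ∈ U, ∀ H ⊆ U, x ∉ H → ConnectedOn G H → ¬ IsTriangle G H →
        ∃ D : Finset V, 5 * D.card ≤ (edgesMeeting G U H).card ∧ Dominates G (insert x D) H := by
      intro x hx H hHU hxH hH hHT
      have hne : H ≠ U := fun e => hxH (e ▸ hx)
      obtain ⟨D, hD, hdom⟩ := hsmall H hHU hne hH hHT
      obtain ⟨a, ha, b, hb, hbH, hab⟩ := hU.exists_adj hH.1 hHU hne
      exact ⟨D, hD.trans (card_edgesIn_add_one_le hHU ha hb hbH hab),
        hdom.mono (subset_insert _ _)⟩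
    by_cases hbad : ∃ x ∈ U, ∃ H, IsTriangle G H ∧ IsClosedIn G H (U \ {x})
    · obtain ⟨x, hx, H₀, hH₀T, hH₀⟩ := hbad
      have htri : ∀ H, IsTriangle G H → IsClosedIn G H (U \ {x}) →
          4 ≤ (edgesMeeting G U H).card ∧ Dominates G (insert x ∅) H := by
        intro H hHT hH
        have h3 := hHT.three_le_card_edgesIn
        obtain ⟨a, b, c, hab, hbc, hac, rfl⟩ := hHT
        have hHU := hH.1.trans sdiff_subset
        have hxH : x ∉ ({a, b, c} : Finset V) := fun h => by simpa using hH.1 h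
        obtain ⟨p, hp, s, hs, hsH, hps⟩ := hU.exists_adj ⟨a, by simp⟩ hHU (fun e => hxH (e ▸ hx))
        have hsx : s = x := by
          by_contra hsx
          exact hsH (hH.2 p hp s (by simp [hs, hsx]) hps)
        subst hsx
        refine ⟨?_, fun C hC hcore => ?_⟩
        · have := card_edgesIn_add_one_le hHU hp hs hsH hps
          omega
        · refine ⟨p, ?_, s, by simp, Or.inr hps.symm⟩
          have : C = {a, b, c} := eq_of_subset_of_card_le hC (card_le_three.trans hcore.three_le_card)
          rwa [this]
      refine exists_dominates_of_delete (x := x) (S := {x}) (H₀ := H₀) (D₀ := ∅) (by simpa) (by simp)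
        (fun H hHc hH => ?_) hH₀ (htri H₀ hH₀T hH₀).2 ?_
      · by_cases hHT : IsTriangle G H
        · exact ⟨∅, by simp, (htri H hHT hHc).2⟩
        · exact hnice x hx H (hHc.1.trans sdiff_subset) (fun h => by simpa using hHc.1 h) hH hHT
      · have := (htri H₀ hH₀T hH₀).1
        simp only [card_empty]
        omega
    push Not at hbad
    have hnice' : ∀ x ∈ U, ∀ S ⊆ U, x ∈ S → ∀ H, IsClosedIn G H (U \ S) → ConnectedOn G H →
        ∃ D : Finset V, 5 * D.card ≤ (edgesMeeting G U H).card ∧ Dominates G (insert x D) H := by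
      intro x hx S hSU hxS H hHc hH
      have hHU := hHc.1.trans sdiff_subset
      have hxH : x ∉ H := fun h => (mem_sdiff.1 (hHc.1 h)).2 hxS
      by_cases hHT : IsTriangle G H
      · obtain ⟨p, hp, s, hs, hsH, hps⟩ := hU.exists_adj hH.1 hHU (fun e => hxH (e ▸ hx))
        have h2 : ∃ p' ∈ H, ∃ s' ∈ U, s' ∉ H ∧ G.Adj p' s' ∧ s ≠ s' := by
          by_contra! hcon
          refine hbad s hs H hHT ⟨fun w hw => ?_, fun a ha b hb hab => ?_⟩
          · simp only [mem_sdiff, mem_singleton]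
            exact ⟨hHU hw, fun e => hsH (e ▸ hw)⟩
          · rw [mem_sdiff, mem_singleton] at hb
            by_contra hbH
            exact hb.2 (hcon a ha b hb.1 hbH hab).symm
        obtain ⟨p', hp', s', hs', hsH', hps', hne⟩ := h2
        have h5 := card_edgesIn_add_two_le hHU hp hs hsH hps hp' hs' hsH' hps' (Or.inr hne)
        have h3 := hHT.three_le_card_edgesIn
        obtain ⟨a, b, c, hab, hbc, hac, rfl⟩ := hHT
        refine ⟨{a}, by rw [card_singleton]; omega, fun C hC hcore => ?_⟩
        obtain ⟨u, hu⟩ := hcore.1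
        refine ⟨u, hu, a, by simp, ?_⟩
        have := hC hu
        simp only [mem_insert, mem_singleton] at this
        rcases this with rfl | rfl | rfl
        · exact Or.inl rfl
        · exact Or.inr hab
        · exact Or.inr hac
      · exact hnice x hx H hHU hxH hH hHT
    let S : V → Finset V := fun v => U.filter fun w => v = w ∨ G.Adj v w
    have hSU : ∀ v, S v ⊆ U := fun v => filter_subset _ _
    have hSv : ∀ v, ∀ w ∈ S v, v = w ∨ G.Adj v w := fun v w hw => (mem_filter.1 hw).2
    have hvS : ∀ v ∈ U, v ∈ S v := fun v hv => mem_filter.2 ⟨hv, Or.inl rfl⟩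
    have hadjS : ∀ v, ∀ w ∈ U, G.Adj v w → w ∈ S v := fun v w hw h => mem_filter.2 ⟨hw, Or.inr h⟩
    by_cases hfour : ∃ v ∈ U, 4 ≤ (edgesIn G (S v)).card
    · obtain ⟨v, hv, h4⟩ := hfour
      refine exists_dominates_of_delete (x := v) (S := S v) (H₀ := ∅) (D₀ := ∅) (hSU v) (hSv v)
        (hnice' v hv (S v) (hSU v) (hvS v hv)) ⟨by simp, by simp⟩
        (fun C hC hcore => absurd hcore.1 (by simp [subset_empty.1 hC])) ?_
      simp only [card_empty]
      omega
    push Not at hfour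
    have hfree : ∀ a ∈ U, ∀ b ∈ U, ∀ c ∈ U, G.Adj a b → G.Adj b c → ¬ G.Adj a c := by
      intro a ha b hb c hc hab hbc hac
      have key : ∀ p ∈ U, ∀ q ∈ U, ∀ r ∈ U, ∀ s ∈ U, G.Adj p q → G.Adj p r → G.Adj q r →
          G.Adj p s → s ≠ q → s ≠ r → False := fun p hp q hq r hr s hs hpq hpr hqr hps hsq hsr =>
        (hfour p hp).not_ge (four_le_card_edgesIn hpq hpr hqr hps hsq hsr (hvS p hp)
          (hadjS p q hq hpq) (hadjS p r hr hpr) (hadjS p s hs hps))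
      obtain ⟨p, hp, s, hs, hsH, hps⟩ := hU.exists_adj (H := {a, b, c}) ⟨a, by simp⟩
        (by simp [insert_subset_iff, ha, hb, hc])
        (fun e => hT ⟨a, b, c, hab, hbc, hac, e.symm⟩)
      simp only [mem_insert, mem_singleton, not_or] at hp hsH
      obtain ⟨hsa, hsb, hsc⟩ := hsH
      rcases hp with rfl | rfl | rfl
      · exact key p ha b hb c hc s hs hab hac hbc hps hsb hsc
      · exact key p hb a ha c hc s hs hab.symm hbc hac hps hsa hsc
      · exact key p hc a ha b hb s hs hac.symm hbc.symm hab hps hsa hsb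
    by_cases hdom : Dominates G ∅ U
    · exact ⟨∅, by simp, hdom⟩
    have hex : ∃ k, ∃ C : Finset V, C.card = k ∧ C ⊆ U ∧ IsCore G C := by
      unfold Dominates at hdom
      push Not at hdom
      obtain ⟨C, hC, hcore, -⟩ := hdom
      exact ⟨_, C, rfl, hC, hcore⟩
    obtain ⟨C, hCcard, hCU, hcore⟩ := Nat.find_spec hex
    have hmin : ∀ C' ⊆ C, IsCore G C' → C' = C := fun C' hC' hcore' =>
      eq_of_subset_of_card_le hC' (hCcard ▸ Nat.find_min' hex ⟨C', rfl, hC'.trans hCU, hcore'⟩)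
    by_cases hdeg : ∃ v ∈ C, ∃ r ∈ U, r ∉ C ∧ G.Adj v r
    · obtain ⟨v, hv, r, hr, hrC, hvr⟩ := hdeg
      obtain ⟨a, ha, b, hb, hab, hva, hvb⟩ := hcore.2 v hv
      have hvU := hCU hv
      have hthree : 3 ≤ (edgesIn G (S v)).card := by
        have h : ({s(v, a), s(v, b), s(v, r)} : Finset (Sym2 V)).card = 3 := by
          rw [card_eq_three]
          refine ⟨_, _, _, ?_, ?_, ?_, rfl⟩ <;> rw [Ne, Sym2.eq_iff] <;> grind
        rw [← h]
        apply card_le_card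
        simp [insert_subset_iff, mk_mem_edgesIn, hvS v hvU, hadjS v r hr hvr,
          hadjS v a (hCU ha) hva, hadjS v b (hCU hb) hvb, hva, hvb, hvr]
      obtain ⟨c, hc, hcv, hac⟩ : ∃ c ∈ C, c ≠ v ∧ G.Adj a c := by
        obtain ⟨p, hp, q, hq, hpq, hap, haq⟩ := hcore.2 a ha
        by_cases hpv : p = v
        · exact ⟨q, hq, fun e => hpq (hpv.trans e.symm), haq⟩
        · exact ⟨p, hp, hpv, hap⟩
      have hcS : c ∈ U \ S v := by
        refine mem_sdiff.2 ⟨hCU hc, fun h => ?_⟩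
        rcases hSv v c h with h | h
        · exact hcv h.symm
        · exact hfree v hvU a (hCU ha) c (hCU hc) hva hac h
      obtain ⟨H, hcH, hHc, hH⟩ := exists_component (G := G) hcS
      have hHU := hHc.1.trans sdiff_subset
      have hvH : v ∉ H := fun h => (mem_sdiff.1 (hHc.1 h)).2 (hvS v hvU)
      have hHT : ¬ IsTriangle G H := by
        rintro ⟨p, q, r, hpq, hqr, hpr, rfl⟩
        exact hfree p (hHU (by simp)) q (hHU (by simp)) r (hHU (by simp)) hpq hqr hpr
      obtain ⟨D, hD, hDdom⟩ := hsmall H hHU (fun e => hvH (e ▸ hvU)) hH hHT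
      obtain ⟨p, hp, s, hs, hsH, hps⟩ := hU.exists_adj hH.1 hHU (fun e => hvH (e ▸ hvU))
      have h2 : ∃ p' ∈ H, ∃ s' ∈ U, s' ∉ H ∧ G.Adj p' s' ∧ (p ≠ p' ∨ s ≠ s') := by
        by_contra! hcon
        have hcon' : ∀ w ∈ H, ∀ z ∈ U, G.Adj w z → (z ∈ H ∨ (p = w ∧ s = z)) := by
          intro w hw z hz hwz
          by_cases hzH : z ∈ H
          · exact Or.inl hzH
          · exact Or.inr (hcon w hw z hz hzH hwz)
        obtain ⟨C', hC', hcore'⟩ := exists_core_of_forall_ne (G := G) (X := C ∩ H) (h := p) (by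
            by_cases hcp : c = p
            · obtain ⟨q, hq, q', hq', hqq, hcq, hcq'⟩ := hcore.2 c hc
              rcases hcon' c hcH q (hCU hq) hcq with h | h
              · exact ⟨q, mem_inter.2 ⟨hq, h⟩, fun e => hcq.ne (hcp.trans e.symm)⟩
              · rcases hcon' c hcH q' (hCU hq') hcq' with h' | h'
                · exact ⟨q', mem_inter.2 ⟨hq', h'⟩, fun e => hcq'.ne (hcp.trans e.symm)⟩
                · exact absurd (h.2.symm.trans h'.2) hqq
            · exact ⟨c, mem_inter.2 ⟨hc, hcH⟩, hcp⟩) (by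
            intro w hw hwp
            rw [mem_inter] at hw
            obtain ⟨q, hq, q', hq', hqq, hwq, hwq'⟩ := hcore.2 w hw.1
            have h1 := (hcon' w hw.2 q (hCU hq) hwq).resolve_right fun h => hwp h.1.symm
            have h2 := (hcon' w hw.2 q' (hCU hq') hwq').resolve_right fun h => hwp h.1.symm
            exact ⟨q, mem_inter.2 ⟨hq, h1⟩, q', mem_inter.2 ⟨hq', h2⟩, hqq, hwq, hwq'⟩)
        have := hmin C' (hC'.trans inter_subset_left) hcore'
        exact hvH (mem_inter.1 (hC' (this ▸ hv))).2
      obtain ⟨p', hp', s', hs', hsH', hps', hne⟩ := h2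
      have h5 := card_edgesIn_add_two_le hHU hp hs hsH hps hp' hs' hsH' hps' hne
      exact exists_dominates_of_delete (x := v) (S := S v) (H₀ := H) (D₀ := D) (hSU v) (hSv v)
        (hnice' v hvU (S v) (hSU v) (hvS v hvU)) hHc (hDdom.mono (subset_insert _ _)) (by omega)
    · push Not at hdeg
      have hCeq : C = U := hU.2 C hcore.1 ⟨hCU, fun a ha b hb hab => by
        by_contra hbC
        exact hdeg a ha b hb hbC hab⟩
      subst hCeq
      obtain ⟨v, hv⟩ := hcore.1
      refine ⟨{v}, ?_, fun C' hC' hcore' => ?_⟩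
      · obtain ⟨a, ha, b, hb, hab, hva, hvb⟩ := hcore.2 v hv
        have hother : ∀ w ∈ C, ∃ z ∈ C, z ≠ v ∧ G.Adj w z := fun w hw => by
          obtain ⟨p, hp, q, hq, hpq, hwp, hwq⟩ := hcore.2 w hw
          by_cases hpv : p = v
          · exact ⟨q, hq, fun e => hpq (hpv.trans e.symm), hwq⟩
          · exact ⟨p, hp, hpv, hwp⟩
        obtain ⟨c, hc, hcv, hac⟩ := hother a ha
        obtain ⟨d, hd, hdv, hbd⟩ := hother b hb
        have hnab : ¬ G.Adj a b := fun h => hfree v hv a ha b hb hva h hvb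
        have hcb : c ≠ b := fun e => hnab (e ▸ hac)
        have hda : d ≠ a := fun e => hnab (e ▸ hbd).symm
        have hva' := hva.ne
        have hvb' := hvb.ne
        have h : ({s(v, a), s(v, b), s(a, c), s(b, d)} : Finset (Sym2 V)).card = 4 := by
          rw [card_eq_four]
          refine ⟨_, _, _, _, ?_, ?_, ?_, ?_, ?_, ?_, rfl⟩ <;> rw [Ne, Sym2.eq_iff] <;> grind
        have h' : ({s(v, a), s(v, b), s(a, c), s(b, d)} : Finset (Sym2 V)) ⊆ edgesIn G C := by
          simp [insert_subset_iff, mk_mem_edgesIn, *]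
        have := card_le_card h'
        rw [card_singleton]
        omega
      · rw [hmin C' hC' hcore']
        exact ⟨v, hv, v, by simp, Or.inl rfl⟩

end Counting

lemma SimpleGraph.Connected.connectedOn_univ [Fintype V] (hG : G.Connected) :
    ConnectedOn G univ := by
  have := hG.nonempty
  refine ⟨univ_nonempty, fun A ⟨a, ha⟩ hA => eq_univ_of_forall fun w => ?_⟩
  obtain ⟨p⟩ := hG.preconnected a w
  induction p with
  | nil => exact ha
  | cons h _ ih => exact ih (hA.2 _ ha _ (mem_univ _) h)

lemma IsTriangle.nonempty_iso [Fintype V] (h : IsTriangle G univ) :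
    Nonempty (G ≃g cycleGraph 3) := by
  obtain ⟨a, b, c, hab, hbc, hac, huniv⟩ := h
  have hcard : Fintype.card V = 3 := by
    rw [← card_univ, huniv, card_eq_three]
    exact ⟨a, b, c, hab.ne, hac.ne, hbc.ne, rfl⟩
  have htop : ∀ u w, u ≠ w → G.Adj u w := by
    intro u w huw
    have hu := mem_univ u
    have hw := mem_univ w
    rw [huniv] at hu hw
    simp only [mem_insert, mem_singleton] at hu hw
    have := hab.symm
    have := hbc.symm
    have := hac.symm
    grind
  refine ⟨⟨Fintype.equivFinOfCardEq hcard, fun {u w} => ?_⟩⟩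
  rw [cycleGraph_three_eq_top, top_adj]
  exact ⟨fun h => htop u w fun e => h (e ▸ rfl), fun h e => h.ne (Equiv.injective _ e)⟩

lemma HasCopy.exists_core {n : ℕ} (hn : 3 ≤ n) {X : Set V}
    (h : HasCopy (cycleGraph n) (G.induce X)) : ∃ C : Finset V, ↑C ⊆ X ∧ IsCore G C := by
  obtain ⟨f, hf⟩ := h
  obtain ⟨k, rfl⟩ := Nat.exists_eq_add_of_le' hn
  refine ⟨univ.image fun i => (f i : V), by intro w; simp; rintro i rfl; exact (f i).2,
    ⟨f 0, by simp⟩, fun v hv => ?_⟩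
  obtain ⟨i, -, rfl⟩ := mem_image.1 hv
  have hadj : ∀ j, (cycleGraph (k + 3)).Adj i j → G.Adj (f i) (f j) := fun j h => f.map_adj h
  refine ⟨f (i + 1), mem_image_of_mem _ (mem_univ _), f (i - 1), mem_image_of_mem _ (mem_univ _),
    fun e => ?_, hadj _ ?_, hadj _ ?_⟩
  · have h1 := hf (Subtype.ext e)
    have h2 : (1 : Fin (k + 3)) + 1 = 0 := by
      have := congrArg (fun t => t - i + 1) h1
      simpa using this
    have h3 : 2 % (k + 3) = 0 := by simpa [Fin.ext_iff, Fin.val_add] using h2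
    rw [Nat.mod_eq_of_lt (by omega)] at h3
    omega
  · rw [cycleGraph_adj]
    simp
  · rw [cycleGraph_adj]
    simp

end IsolationHelpers


/-- If `G` is a connected graph with exactly `m` edges and `G` is not a
triangle, then `ι(G, 𝓒) ≤ (m+1)/5`, where `𝓒` is the set of all cycles. -/
theorem isolation_cycles_le_edges {V : Type*} [Fintype V] (G : SimpleGraph V) (m : ℕ)
    (hm : G.edgeSet.ncard = m) (hconn : G.Connected)
    (hC3 : ¬ Nonempty (G ≃g cycleGraph 3)) :
    (iotaCycGE 3 G : ℝ) ≤ (m + 1) / 5 := by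
  classical
  obtain ⟨D, hcard, hdom⟩ := hconn.connectedOn_univ.exists_dominates
    (fun h => hC3 h.nonempty_iso)
  have hedges : (edgesIn G Finset.univ).card ≤ m := by
    rw [← hm, Set.ncard_eq_toFinset_card']
    exact Finset.card_le_card fun e he => by
      simpa using (Finset.mem_filter.1 he).1
  have hiota : iotaCycGE 3 G ≤ D.card := by
    refine Nat.sInf_le ⟨D, Set.ncard_coe_finset D, fun n hn hcopy => ?_⟩
    obtain ⟨C, hC, hcore⟩ := hcopy.exists_core hn
    obtain ⟨u, hu, d, hd, hdu⟩ := hdom C (Finset.subset_univ _) hcore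
    refine hC hu ?_
    rcases hdu with rfl | hdu
    · exact Or.inl hd
    · exact Or.inr ⟨d, hd, hdu⟩
  rw [le_div_iff₀ (by norm_num)]
  have : iotaCycGE 3 G * 5 ≤ m + 1 := by omega
  exact_mod_cast this
end

section
/- Let G be a graph, let 𝓕 be a set of cycles, and let y be a vertex of G of degree 0 or of degree 1. Then ι(G, 𝓕) = ι(G − y, 𝓕). -/
open SimpleGraph

/-- `D` is an isolating set of `G` with respect to the set of cycles `{C_n : n ∈ S}` :
the graph `G − N[D]` contains no copy of `C_n` for any `n ∈ S`. -/
def IsCycSetIsolating {V : Type*} (S : Set ℕ) (G : SimpleGraph V) (D : Set V) : Prop :=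
  ∀ n ∈ S, ¬ HasCopy (cycleGraph n) (G.induce (closedNbhd G D)ᶜ)

/-- The isolation number of `G` with respect to the set of cycles `{C_n : n ∈ S}`. -/
noncomputable def iotaCycSet {V : Type*} (S : Set ℕ) (G : SimpleGraph V) : ℕ :=
  sInf {r | ∃ D : Set V, D.ncard = r ∧ IsCycSetIsolating S G D}

theorem HasCopy.mono {W V : Type*} {F : SimpleGraph W} {G : SimpleGraph V} {s t : Set V}
    (h : HasCopy F (G.induce s)) (hst : s ⊆ t) : HasCopy F (G.induce t) := by
  obtain ⟨f, hf⟩ := h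
  exact ⟨(G.induceHomOfLE hst).toHom.comp f, (G.induceHomOfLE hst).injective.comp hf⟩

theorem hasCopy_induce_induce {W V : Type*} {F : SimpleGraph W} {G : SimpleGraph V} {s : Set V}
    {t : Set s} : HasCopy F ((G.induce s).induce t) ↔ HasCopy F (G.induce (Subtype.val '' t)) := by
  constructor
  · rintro ⟨f, hf⟩
    refine ⟨⟨fun w => ⟨(f w).1, (f w).1, (f w).2, rfl⟩, fun h => f.map_adj h⟩, fun a b h => hf ?_⟩
    simpa [Subtype.ext_iff] using h
  · rintro ⟨f, hf⟩
    have hs : ∀ w, ∃ h : (f w : V) ∈ s, (⟨f w, h⟩ : s) ∈ t := fun w => by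
      obtain ⟨x, hx, hxw⟩ := (f w).2
      exact ⟨hxw ▸ x.2, by simpa [← hxw] using hx⟩
    refine ⟨⟨fun w => ⟨⟨f w, (hs w).1⟩, (hs w).2⟩, fun h => f.map_adj h⟩, fun a b h => hf ?_⟩
    simp only [Subtype.ext_iff] at h ⊢
    exact h

/-- A cycle in a graph avoids every vertex with at most one neighbour. -/
theorem HasCopy.cycleGraph_diff_singleton {V : Type*} {G : SimpleGraph V} {s : Set V} {n : ℕ}
    {y : V} (hn : 3 ≤ n) (hy : (G.neighborSet y).Subsingleton)
    (h : HasCopy (cycleGraph n) (G.induce s)) : HasCopy (cycleGraph n) (G.induce (s \ {y})) := by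
  obtain ⟨f, hf⟩ := h
  have hne : ∀ w, (f w : V) ≠ y := by
    intro w hw
    obtain ⟨m, rfl⟩ := Nat.exists_eq_add_of_le' hn
    have hdeg : 1 < ((cycleGraph (m + 3)).neighborFinset w).card := by
      rw [card_neighborFinset_eq_degree, cycleGraph_degree_three_le]
      norm_num
    obtain ⟨a, ha, b, hb, hab⟩ := Finset.one_lt_card.1 hdeg
    rw [mem_neighborFinset] at ha hb
    have hadj : ∀ c, (cycleGraph (m + 3)).Adj w c → (f c : V) ∈ G.neighborSet y := fun c hc =>
      hw ▸ (f.map_adj hc : G.Adj (f w) (f c))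
    exact hab (hf (Subtype.ext (hy (hadj a ha) (hadj b hb))))
  refine ⟨⟨fun w => ⟨f w, (f w).2, hne w⟩, fun h => f.map_adj h⟩, fun a b h => hf ?_⟩
  rw [Subtype.ext_iff] at h ⊢
  exact h

theorem isCycSetIsolating_univ {V : Type*} {S : Set ℕ} (hS : ∀ n ∈ S, n ≠ 0)
    (G : SimpleGraph V) : IsCycSetIsolating S G Set.univ := by
  rintro n hn ⟨f, -⟩
  exact (f ⟨0, Nat.pos_of_ne_zero (hS n hn)⟩).2 (Or.inl trivial)

theorem iotaCycSet_le_of_forall {V W : Type*} {S : Set ℕ} (hS : ∀ n ∈ S, n ≠ 0)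
    {G : SimpleGraph V} {H : SimpleGraph W}
    (h : ∀ D, IsCycSetIsolating S H D → ∃ D', D'.ncard ≤ D.ncard ∧ IsCycSetIsolating S G D') :
    iotaCycSet S G ≤ iotaCycSet S H := by
  have hne : {r | ∃ D : Set W, D.ncard = r ∧ IsCycSetIsolating S H D}.Nonempty :=
    ⟨_, _, rfl, isCycSetIsolating_univ hS H⟩
  obtain ⟨D, hD, hiso⟩ := Nat.sInf_mem hne
  obtain ⟨D', hle, hiso'⟩ := h D hiso
  exact (Nat.sInf_le (Exists.intro D' ⟨rfl, hiso'⟩)).trans (hle.trans_eq hD)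

theorem IsCycSetIsolating.image_val {V : Type*} {G : SimpleGraph V} {S : Set ℕ}
    (hS : ∀ n ∈ S, 3 ≤ n) {y : V} (hy : (G.neighborSet y).Subsingleton)
    {D : Set ({y}ᶜ : Set V)} (hD : IsCycSetIsolating S (G.induce {y}ᶜ) D) :
    IsCycSetIsolating S G (Subtype.val '' D) := by
  intro n hn hcopy
  refine hD n hn (hasCopy_induce_induce.2
    ((hcopy.cycleGraph_diff_singleton (hS n hn) hy).mono ?_))
  rintro v ⟨hv, hvy⟩
  refine ⟨⟨v, hvy⟩, ?_, rfl⟩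
  rintro (h | ⟨u, hu, huv⟩)
  · exact hv (Or.inl ⟨_, h, rfl⟩)
  · exact hv (Or.inr ⟨u, ⟨u, hu, rfl⟩, huv⟩)

/-- In an isolating set, a deleted vertex can be replaced by its neighbours. -/
theorem IsCycSetIsolating.preimage_val {V : Type*} {G : SimpleGraph V} {S : Set ℕ} {y : V}
    {D : Set V} (hD : IsCycSetIsolating S G D) :
    IsCycSetIsolating S (G.induce {y}ᶜ) {v | v.1 ∈ D ∨ y ∈ D ∧ G.Adj y v} := by
  intro n hn hcopy
  refine hD n hn ((hasCopy_induce_induce.1 hcopy).mono ?_)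
  rintro _ ⟨v, hv, rfl⟩ (h | ⟨u, hu, huv⟩)
  · exact hv (Or.inl (Or.inl h))
  · by_cases huy : u = y
    · subst huy
      exact hv (Or.inl (Or.inr ⟨hu, huv⟩))
    · exact hv (Or.inr ⟨⟨u, huy⟩, Or.inl hu, huv⟩)

theorem ncard_replace_by_neighborSet_le {V : Type*} [Finite V] {G : SimpleGraph V} {y : V}
    (hy : (G.neighborSet y).ncard ≤ 1) (D : Set V) :
    {v : ({y}ᶜ : Set V) | v.1 ∈ D ∨ y ∈ D ∧ G.Adj y v}.ncard ≤ D.ncard := by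
  rw [← Set.ncard_image_of_injective _ Subtype.val_injective]
  by_cases hyD : y ∈ D
  · calc
      _ ≤ (D \ {y} ∪ G.neighborSet y).ncard := by
        refine Set.ncard_le_ncard ?_
        rintro _ ⟨v, hv | hv, rfl⟩
        exacts [Or.inl ⟨hv, v.2⟩, Or.inr hv.2]
      _ ≤ (D \ {y}).ncard + (G.neighborSet y).ncard := Set.ncard_union_le _ _
      _ ≤ (D \ {y}).ncard + 1 := by gcongr
      _ = D.ncard := Set.ncard_sdiff_singleton_add_one hyD
  · refine Set.ncard_le_ncard ?_
    rintro _ ⟨v, hv | hv, rfl⟩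
    exacts [hv, absurd hv.1 hyD]

/-- If `G` is a graph, `𝓕 = {C_n : n ∈ S}` is a set of cycles, and `y` is a
vertex of `G` of degree 0 or of degree 1, then `ι(G, 𝓕) = ι(G − y, 𝓕)`. -/
theorem isolation_eq_delete_leaf {V : Type*} [Fintype V] (G : SimpleGraph V)
    (S : Set ℕ) (hS : ∀ n ∈ S, 3 ≤ n) (y : V)
    (hy : (G.neighborSet y).ncard = 0 ∨ (G.neighborSet y).ncard = 1) :
    iotaCycSet S G = iotaCycSet S (G.induce ({y} : Set V)ᶜ) := by
  have hy' : (G.neighborSet y).ncard ≤ 1 := by lia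
  have hS' : ∀ n ∈ S, n ≠ 0 := fun n hn => by have := hS n hn; lia
  refine le_antisymm (iotaCycSet_le_of_forall hS' fun D hD => ?_)
    (iotaCycSet_le_of_forall hS' fun D hD => ?_)
  · exact ⟨_, (Set.ncard_image_of_injective D Subtype.val_injective).le,
      hD.image_val hS (Set.ncard_le_one_iff_subsingleton.1 hy')⟩
  · exact ⟨_, ncard_replace_by_neighborSet_le hy' D, hD.preimage_val⟩
end
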